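/- Let p be an odd prime such that the multiplicative order g of 2 in (ℤ/pℤ)^* is even. Let n = 2^b + 2^a where b > a ≥ 0 and n > 2p−1, and suppose a ≡ b ≡ g/2 (mod g). Then the cyclotomic polynomial Φ_{2p}(t) divides the descent set polynomial Q_n(t). -/

import Mathlib

/-- The descent set of a permutation of `Fin n`, as a subset of `[n-1] = {1,…,n-1}`
(1-based positions): `i` is a descent if `π(i) > π(i+1)`. -/
def descentSet (n : ℕ) (π : Equiv.Perm (Fin n)) : Finset ℕ :=
  (Finset.Ico 1 n).filter fun i => ∀ h : i < n, π ⟨i, h⟩ < π ⟨i - 1, by omega⟩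

/-- The descent set statistic `β_n(S)`: the number of permutations of `{1,…,n}`
with descent set `S`. -/
def beta (n : ℕ) (S : Finset ℕ) : ℕ :=
  (Finset.univ.filter fun π : Equiv.Perm (Fin n) => descentSet n π = S).card

/-- The descent set polynomial `Q_n(t) = ∑_{S ⊆ [n-1]} t^{β_n(S)}`. -/
noncomputable def Q (n : ℕ) : Polynomial ℤ :=
  ∑ S ∈ (Finset.Ico 1 n).powerset, Polynomial.X ^ beta n S

theorem mem_descentSet {n q : ℕ} {π : Equiv.Perm (Fin n)} :
    q ∈ descentSet n π ↔ 1 ≤ q ∧ ∃ h : q < n, π ⟨q, h⟩ < π ⟨q - 1, by omega⟩ := by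
  simp only [descentSet, Finset.mem_filter, Finset.mem_Ico]
  constructor
  · rintro ⟨⟨h1, h2⟩, h3⟩
    exact ⟨h1, h2, h3 h2⟩
  · rintro ⟨h1, h2, h3⟩
    exact ⟨⟨h1, h2⟩, fun _ => h3⟩

theorem beta_empty (n : ℕ) : beta n ∅ = 1 := by
  rw [beta, Finset.card_eq_one]
  refine ⟨1, ?_⟩
  ext π
  simp only [Finset.mem_filter, Finset.mem_univ, true_and, Finset.mem_singleton]
  constructor
  · intro h
    have hmono : StrictMono π := by
      cases n with
      | zero => exact fun x => x.elim0
      | succ n =>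
        rw [Fin.strictMono_iff_lt_succ]
        intro i
        have hi : (i : ℕ) + 1 ∉ descentSet (n + 1) π := by simp [h]
        rw [mem_descentSet] at hi
        push Not at hi
        have h3 := hi (by omega) (by omega)
        refine lt_of_le_of_ne h3 fun h4 => ?_
        have h5 := congrArg Fin.val (π.injective h4)
        simp at h5
    have h2 : hmono.orderIsoOfSurjective π π.surjective = OrderIso.refl _ :=
      Subsingleton.elim _ _
    ext x
    exact congrArg (fun e : Fin n ≃o Fin n => ((e x : Fin n) : ℕ)) h2
  · rintro rfl
    ext q
    simp only [mem_descentSet, Equiv.Perm.coe_one, id, Fin.mk_lt_mk, Finset.notMem_empty,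
      iff_false]
    rintro ⟨h1, h2, h3⟩
    omega

/-- The permutation whose first `k` values are the elements of `A`, ordered according to `σ`, and
whose remaining values are the elements of the complement of `A`, ordered according to `τ`. -/
def shufflePerm {k m : ℕ} (A : {A : Finset (Fin (k + m)) // A.card = k})
    (σ : Equiv.Perm (Fin k)) (τ : Equiv.Perm (Fin m)) : Equiv.Perm (Fin (k + m)) :=
  (finSumFinEquiv.symm.trans (Equiv.sumCongr σ τ)).trans
    (finSumEquivOfFinset A.2 (by rw [Finset.card_compl, A.2, Fintype.card_fin]; omega))

theorem shufflePerm_castAdd {k m : ℕ} (A : {A : Finset (Fin (k + m)) // A.card = k})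
    (σ : Equiv.Perm (Fin k)) (τ : Equiv.Perm (Fin m)) (x : Fin k) :
    shufflePerm A σ τ (Fin.castAdd m x) = A.1.orderEmbOfFin A.2 (σ x) := by
  simp [shufflePerm]

theorem shufflePerm_natAdd {k m : ℕ} (A : {A : Finset (Fin (k + m)) // A.card = k})
    (σ : Equiv.Perm (Fin k)) (τ : Equiv.Perm (Fin m)) (x : Fin m) :
    shufflePerm A σ τ (Fin.natAdd k x) =
      (A.1ᶜ).orderEmbOfFin (by rw [Finset.card_compl, A.2, Fintype.card_fin]; omega) (τ x) := by
  simp [shufflePerm]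

theorem mem_descentSet_shufflePerm_of_lt {k m q : ℕ}
    (A : {A : Finset (Fin (k + m)) // A.card = k})
    (σ : Equiv.Perm (Fin k)) (τ : Equiv.Perm (Fin m)) (hq : q < k) :
    q ∈ descentSet (k + m) (shufflePerm A σ τ) ↔ q ∈ descentSet k σ := by
  have h0 : q < k + m := by omega
  have h1 := shufflePerm_castAdd A σ τ ⟨q, hq⟩
  have h2 := shufflePerm_castAdd A σ τ ⟨q - 1, by omega⟩
  simp only [Fin.castAdd_mk] at h1 h2
  simp only [mem_descentSet, h1, h2, OrderEmbedding.lt_iff_lt, hq, h0, exists_true_left]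

theorem mem_descentSet_shufflePerm_add {k m q : ℕ}
    (A : {A : Finset (Fin (k + m)) // A.card = k})
    (σ : Equiv.Perm (Fin k)) (τ : Equiv.Perm (Fin m)) (hq : 1 ≤ q) :
    k + q ∈ descentSet (k + m) (shufflePerm A σ τ) ↔ q ∈ descentSet m τ := by
  by_cases hm : q < m
  · have h0 : k + q < k + m := by omega
    have h1 := shufflePerm_natAdd A σ τ ⟨q, hm⟩
    have h2 := shufflePerm_natAdd A σ τ ⟨q - 1, by omega⟩
    simp only [Fin.natAdd_mk] at h1 h2
    have h3 : 1 ≤ k + q := by omega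
    simp only [mem_descentSet, h1, Nat.add_sub_assoc hq, h2, OrderEmbedding.lt_iff_lt, hm, h0,
      exists_true_left, hq, h3]
  · simp [mem_descentSet, hm]

theorem shufflePerm_bijective (k m : ℕ) :
    Function.Bijective
      fun x : {A : Finset (Fin (k + m)) // A.card = k} × Equiv.Perm (Fin k) × Equiv.Perm (Fin m) =>
        shufflePerm x.1 x.2.1 x.2.2 := by
  rw [Fintype.bijective_iff_injective_and_card]
  constructor
  · rintro ⟨A, σ, τ⟩ ⟨B, σ', τ'⟩ h
    simp only at h
    have himage : ∀ (A : {A : Finset (Fin (k + m)) // A.card = k}) (σ : Equiv.Perm (Fin k))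
        (τ : Equiv.Perm (Fin m)),
        (A.1 : Set (Fin (k + m))) = Set.range fun x => shufflePerm A σ τ (Fin.castAdd m x) := by
      intro A σ τ
      simp only [shufflePerm_castAdd]
      rw [← Finset.range_orderEmbOfFin A.1 A.2]
      exact (σ.surjective.range_comp _).symm
    obtain rfl : A = B := by
      apply Subtype.ext
      apply Finset.coe_injective
      rw [himage A σ τ, himage B σ' τ', h]
    obtain rfl : σ = σ' := by
      ext1 x
      have h1 := shufflePerm_castAdd A σ τ x
      rw [h, shufflePerm_castAdd] at h1
      exact ((A.1.orderEmbOfFin A.2).injective h1).symm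
    obtain rfl : τ = τ' := by
      ext1 x
      have h1 := shufflePerm_natAdd A σ τ x
      rw [h, shufflePerm_natAdd] at h1
      exact ((A.1ᶜ.orderEmbOfFin _).injective h1).symm
    rfl
  · have h := Nat.add_choose_mul_factorial_mul_factorial k m
    simp only [Fintype.card_prod, Fintype.card_perm, Fintype.card_fin,
      Fintype.card_finset_len]
    rw [← h, mul_assoc, Nat.choose_symm_add]

theorem beta_add_beta_insert {k m : ℕ} {S : Finset ℕ}
    (hS : S ⊆ Finset.Ico 1 (k + m)) (hkS : k ∉ S) :
    beta (k + m) S + beta (k + m) (insert k S) =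
      (k + m).choose k * (beta k (S.filter (· < k)) *
        beta m ((Finset.Ico 1 m).filter (k + · ∈ S))) := by
  have hdisj : Disjoint
      (Finset.univ.filter fun π : Equiv.Perm (Fin (k + m)) => descentSet (k + m) π = S)
      (Finset.univ.filter fun π : Equiv.Perm (Fin (k + m)) =>
        descentSet (k + m) π = insert k S) := by
    rw [Finset.disjoint_filter]
    rintro π - h1 h2
    exact hkS (by rw [← h1, h2]; simp)
  have hcard : Fintype.card {A : Finset (Fin (k + m)) // A.card = k} = (k + m).choose k := by
    simp
  rw [beta, beta, ← Finset.card_union_of_disjoint hdisj, ← hcard, ← Finset.card_univ, beta, beta,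
    ← Finset.card_product, ← Finset.card_product]
  symm
  refine Finset.card_bijective _ (shufflePerm_bijective k m) ?_
  rintro ⟨A, σ, τ⟩
  simp only [Finset.mem_product, Finset.mem_univ, true_and, Finset.mem_filter, Finset.mem_union]
  have herase : ∀ T : Finset ℕ, (T = S ∨ T = insert k S) ↔ ∀ q, q ≠ k → (q ∈ T ↔ q ∈ S) := by
    intro T
    constructor
    · rintro (rfl | rfl) q hq <;> simp [hq]
    · intro h
      by_cases hT : k ∈ T
      · right
        ext q
        by_cases hq : q = k
        · simp [hq, hT]
        · simp [hq, h q hq]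
      · left
        ext q
        by_cases hq : q = k
        · simp [hq, hT, hkS]
        · exact h q hq
  rw [herase]
  constructor
  · rintro ⟨h1, h2⟩ q hq
    rcases lt_or_gt_of_ne hq with hlt | hgt
    · rw [mem_descentSet_shufflePerm_of_lt A σ τ hlt, h1]
      simp [hlt]
    · obtain ⟨r, rfl⟩ := Nat.exists_eq_add_of_lt hgt
      rw [add_assoc, mem_descentSet_shufflePerm_add A σ τ (by omega), h2]
      simp only [Finset.mem_filter, Finset.mem_Ico, and_iff_right_iff_imp]
      intro h
      have := Finset.mem_Ico.1 (hS h)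
      omega
  · intro h
    constructor
    · ext q
      by_cases hq : q < k
      · rw [← mem_descentSet_shufflePerm_of_lt A σ τ hq, h q hq.ne]
        simp [hq]
      · simp [mem_descentSet, hq]
    · ext q
      by_cases hq : 1 ≤ q
      · rw [← mem_descentSet_shufflePerm_add A σ τ hq, h _ (by omega)]
        simp only [Finset.mem_filter, Finset.mem_Ico, iff_and_self]
        intro h
        have := Finset.mem_Ico.1 (hS h)
        omega
      · simp [mem_descentSet, hq]

theorem choose_dvd_beta_add_beta_insert {n i : ℕ} (hi : i ∈ Finset.Ico 1 n) {S : Finset ℕ}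
    (hS : S ⊆ Finset.Ico 1 n) (hiS : i ∉ S) :
    n.choose i ∣ beta n S + beta n (insert i S) := by
  rw [Finset.mem_Ico] at hi
  obtain ⟨m, rfl⟩ := Nat.exists_eq_add_of_lt hi.2
  rw [add_assoc] at hS ⊢
  rw [beta_add_beta_insert hS hiS]
  exact dvd_mul_right _ _

theorem odd_beta_two_pow (k : ℕ) {S : Finset ℕ} (hS : S ⊆ Finset.Ico 1 (2 ^ k)) :
    Odd (beta (2 ^ k) S) := by
  induction S using Finset.induction_on with
  | empty => simp [beta_empty]
  | insert i S hi ih =>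
    rw [Finset.insert_subset_iff] at hS
    have h2 := Finset.mem_Ico.1 hS.1
    have h1 : 2 ∣ (2 ^ k).choose i := Nat.prime_two.dvd_choose_pow (by omega) (by omega)
    have h3 := h1.trans (choose_dvd_beta_add_beta_insert hS.1 hS.2 hi)
    have h4 := ih hS.2
    rw [Nat.odd_iff] at h4 ⊢
    omega

theorem odd_choose_two_pow_add_two_pow {a b j : ℕ} (hab : a < b) (hj : 0 < j)
    (hjn : j < 2 ^ a + 2 ^ b) :
    Odd ((2 ^ a + 2 ^ b).choose j) ↔ j = 2 ^ a ∨ j = 2 ^ b := by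
  have hlt : 2 ^ a < 2 ^ b := Nat.pow_lt_pow_right (by norm_num) hab
  have h : (((2 ^ a + 2 ^ b).choose j : ℕ) : ZMod 2) = if j = 2 ^ a ∨ j = 2 ^ b then 1 else 0 := by
    rw [← Polynomial.coeff_one_add_X_pow, pow_add, add_pow_char_pow, add_pow_char_pow]
    simp only [one_pow, mul_add, add_mul, one_mul, mul_one, ← pow_add, Polynomial.coeff_add,
      Polynomial.coeff_one, Polynomial.coeff_X_pow]
    rw [if_neg hj.ne', if_neg hjn.ne]
    by_cases h1 : j = 2 ^ a
    · subst h1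
      simp [hlt.ne]
    · by_cases h2 : j = 2 ^ b <;> simp [h1, h2, hab.ne']
  rw [← ZMod.natCast_eq_one_iff_odd, h]
  split_ifs with h1 <;> simp [h1]

theorem dvd_choose_of_mod_lt_mod {p n i : ℕ} (hp : p.Prime) (h : n % p < i % p) :
    p ∣ n.choose i := by
  have := Fact.mk hp
  have h1 := @Choose.choose_modEq_choose_mod_mul_choose_div_nat n i p _
  rw [Nat.choose_eq_zero_of_lt h, zero_mul] at h1
  exact (Nat.modEq_zero_iff_dvd).1 h1

theorem cyclotomic_two_mul_dvd_X_pow_add_one {p : ℕ} (hp : 0 < p) :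
    Polynomial.cyclotomic (2 * p) ℤ ∣ Polynomial.X ^ p + 1 := by
  have h := Polynomial.X_pow_sub_one_mul_cyclotomic_dvd_X_pow_sub_one_of_dvd ℤ
    (d := p) (n := 2 * p) (by rw [Nat.mem_properDivisors]; exact ⟨dvd_mul_left _ _, by omega⟩)
  have h1 : (Polynomial.X ^ (2 * p) - 1 : Polynomial ℤ) =
      (Polynomial.X ^ p - 1) * (Polynomial.X ^ p + 1) := by ring
  rw [h1] at h
  exact (mul_dvd_mul_iff_left (Polynomial.X_pow_sub_C_ne_zero hp (1 : ℤ))).1 (by simpa using h)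

theorem cyclotomic_two_mul_dvd_X_pow_add_X_pow {p x z : ℕ} (hp : Odd p)
    (hxz : (p : ℤ) ∣ z - x) (hodd : Odd (x + z)) :
    Polynomial.cyclotomic (2 * p) ℤ ∣ Polynomial.X ^ x + Polynomial.X ^ z := by
  wlog hle : x ≤ z generalizing x z
  · rw [add_comm]
    exact this (by rwa [dvd_sub_comm]) (by rwa [add_comm]) (by omega)
  obtain ⟨e, rfl⟩ := Nat.exists_eq_add_of_le hle
  have hpe : p ∣ e := by
    rw [← Int.natCast_dvd_natCast]
    simpa using hxz
  obtain ⟨d, rfl⟩ := hpe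
  have hd : Odd d := by
    have h : Odd (p * d) := by
      rw [Nat.odd_iff] at hodd ⊢
      omega
    exact (Nat.odd_mul.1 h).2
  have h1 := hd.add_dvd_pow_add_pow (Polynomial.X ^ p : Polynomial ℤ) 1
  rw [one_pow, ← pow_mul] at h1
  have h2 : (Polynomial.X ^ x + Polynomial.X ^ (x + p * d) : Polynomial ℤ) =
      Polynomial.X ^ x * (Polynomial.X ^ (p * d) + 1) := by ring
  rw [h2]
  exact ((cyclotomic_two_mul_dvd_X_pow_add_one hp.pos).trans h1).mul_left _

theorem two_pow_eq_neg_one {p c : ℕ} (hp : p.Prime) (hpodd : Odd p)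
    (heven : Even (orderOf (2 : ZMod p)))
    (hc : c % orderOf (2 : ZMod p) = orderOf (2 : ZMod p) / 2 % orderOf (2 : ZMod p)) :
    (2 : ZMod p) ^ c = -1 := by
  have := Fact.mk hp
  have h2 : (2 : ZMod p) ≠ 0 := by
    intro h
    have h1 : ((2 : ℕ) : ZMod p) = 0 := by exact_mod_cast h
    rw [ZMod.natCast_eq_zero_iff, Nat.prime_dvd_prime_iff_eq hp Nat.prime_two] at h1
    subst h1
    exact absurd hpodd (by decide)
  have hpos : 0 < orderOf (2 : ZMod p) := by
    rw [orderOf_pos_iff]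
    exact isOfFinOrder_iff_pow_eq_one.2
      ⟨p - 1, by have := hp.two_le; omega, ZMod.pow_card_sub_one_eq_one h2⟩
  rw [← pow_mod_orderOf, hc, pow_mod_orderOf]
  obtain ⟨r, hr⟩ := heven
  have hr2 : orderOf (2 : ZMod p) / 2 = r := by omega
  rw [hr2]
  have hsq : (2 : ZMod p) ^ r * 2 ^ r = 1 := by rw [← pow_add, ← hr, pow_orderOf_eq_one]
  refine (mul_self_eq_one_iff.1 hsq).resolve_left ?_
  exact pow_ne_one_of_lt_orderOf (by omega) (by omega)

theorem mod_eq_sub_one_of_cast_eq_neg_one {p c : ℕ} (hp : 0 < p) (hc : (c : ZMod p) = -1) :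
    c % p = p - 1 := by
  have h : ((c + 1 : ℕ) : ZMod p) = 0 := by simp [hc]
  rw [ZMod.natCast_eq_zero_iff] at h
  obtain ⟨d, hd⟩ := h
  cases d with
  | zero => simp at hd
  | succ d =>
    have : c = p - 1 + p * d := by rw [mul_add] at hd; omega
    rw [this, Nat.add_mul_mod_self_left, Nat.mod_eq_of_lt (by omega)]

/-- Let `p` be an odd prime for which the multiplicative order `g` of `2` modulo
`p` is even, and let `n = 2^b + 2^a` with `b > a ≥ 0` and `n > 2p - 1`. If
`a ≡ b ≡ g/2 (mod g)`, then `Φ_{2p}` divides `Q_n(t)`. -/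
theorem cyclotomic_two_p_dvd_even_order_two (p a b g : ℕ) (hp : p.Prime) (hpodd : Odd p)
    (hg : g = orderOf (2 : ZMod p)) (hgeven : Even g)
    (hab : a < b) (hn : 2 * p - 1 < 2 ^ b + 2 ^ a)
    (hca : a % g = g / 2 % g) (hcb : b % g = g / 2 % g) :
    Polynomial.cyclotomic (2 * p) ℤ ∣ Q (2 ^ b + 2 ^ a) := by
  subst hg
  have hp2 := hp.two_le
  have hp3 : p % 2 = 1 := Nat.odd_iff.1 hpodd
  have hlt : 2 ^ a < 2 ^ b := Nat.pow_lt_pow_right (by norm_num) hab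
  have hpa : 0 < 2 ^ a := by positivity
  have hma : 2 ^ a % p = p - 1 := mod_eq_sub_one_of_cast_eq_neg_one hp.pos
    (by push_cast; exact two_pow_eq_neg_one hp hpodd hgeven hca)
  have hmb : 2 ^ b % p = p - 1 := mod_eq_sub_one_of_cast_eq_neg_one hp.pos
    (by push_cast; exact two_pow_eq_neg_one hp hpodd hgeven hcb)
  have hj : ∀ c, 2 * p - 1 ≠ 2 ^ c := by
    rintro (_ | c) hc
    · omega
    · rw [pow_succ] at hc
      omega
  rw [add_comm (2 ^ b)] at hn ⊢
  have hmn : (2 ^ a + 2 ^ b) % p = p - 2 := by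
    rw [Nat.add_mod, hma, hmb, show p - 1 + (p - 1) = p - 2 + p by omega, Nat.add_mod_right,
      Nat.mod_eq_of_lt (by omega)]
  have hmj : (2 * p - 1) % p = p - 1 := by
    rw [show 2 * p - 1 = p - 1 + p by omega, Nat.add_mod_right, Nat.mod_eq_of_lt (by omega)]
  have hpi : p ∣ (2 ^ a + 2 ^ b).choose (2 ^ a) :=
    dvd_choose_of_mod_lt_mod hp (by rw [hmn, hma]; omega)
  have hpj : p ∣ (2 ^ a + 2 ^ b).choose (2 * p - 1) :=
    dvd_choose_of_mod_lt_mod hp (by rw [hmn, hmj]; omega)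
  have hoddi : Odd ((2 ^ a + 2 ^ b).choose (2 ^ a)) :=
    (odd_choose_two_pow_add_two_pow hab hpa (by omega)).2 (Or.inl rfl)
  have hevenj : 2 ∣ (2 ^ a + 2 ^ b).choose (2 * p - 1) := by
    rw [← even_iff_two_dvd, ← Nat.not_odd_iff_even,
      odd_choose_two_pow_add_two_pow hab (by omega) hn]
    simp [hj]
  have himem : 2 ^ a ∈ Finset.Ico 1 (2 ^ a + 2 ^ b) := by rw [Finset.mem_Ico]; omega
  have hjmem : 2 * p - 1 ∈ Finset.Ico 1 (2 ^ a + 2 ^ b) := by rw [Finset.mem_Ico]; omega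
  have hij : 2 * p - 1 ≠ 2 ^ a := hj a
  have hparity : ∀ T ⊆ Finset.Ico 1 (2 ^ a + 2 ^ b), 2 ^ a ∉ T →
      Odd (beta (2 ^ a + 2 ^ b) T + beta (2 ^ a + 2 ^ b) (insert (2 ^ a) T)) := by
    intro T hT hiT
    rw [beta_add_beta_insert hT hiT]
    refine hoddi.mul ((odd_beta_two_pow a ?_).mul (odd_beta_two_pow b (Finset.filter_subset _ _)))
    intro q hq
    rw [Finset.mem_filter] at hq
    have := Finset.mem_Ico.1 (hT hq.1)
    rw [Finset.mem_Ico]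
    omega
  generalize 2 * p - 1 = j at *
  generalize 2 ^ a = i at *
  generalize i + 2 ^ b = n at *
  have hins : Finset.Ico 1 n = insert i (insert j (((Finset.Ico 1 n).erase i).erase j)) := by
    rw [Finset.insert_erase (by simp [hij, hjmem] : j ∈ (Finset.Ico 1 n).erase i),
      Finset.insert_erase himem]
  rw [Q, hins, Finset.sum_powerset_insert (by simp [hij.symm]),
    Finset.sum_powerset_insert (by simp), Finset.sum_powerset_insert (by simp),
    ← Finset.sum_add_distrib, ← Finset.sum_add_distrib, ← Finset.sum_add_distrib]
  refine Finset.dvd_sum fun T hT => ?_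
  rw [Finset.mem_powerset] at hT
  have hjT : j ∉ T := fun h => by simpa using hT h
  have hiT : i ∉ T := fun h => by simpa using hT h
  have hTn : T ⊆ Finset.Ico 1 n :=
    hT.trans ((Finset.erase_subset _ _).trans (Finset.erase_subset _ _))
  have hiTn : insert i T ⊆ Finset.Ico 1 n := Finset.insert_subset himem hTn
  have hjiT : j ∉ insert i T := by simp [hij, hjT]
  have h1 := hparity T hTn hiT
  have h2 := hpi.trans (choose_dvd_beta_add_beta_insert himem hTn hiT)
  have h3 := choose_dvd_beta_add_beta_insert hjmem hTn hjT
  have h4 := choose_dvd_beta_add_beta_insert hjmem hiTn hjiT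
  have h5 := hevenj.trans h3
  have h6 := hevenj.trans h4
  replace h3 := hpj.trans h3
  replace h4 := hpj.trans h4
  rw [Finset.insert_comm j i] at h4 h6
  rw [← Int.natCast_dvd_natCast] at h2 h3 h4
  push_cast at h2 h3 h4
  have hT1 : Polynomial.cyclotomic (2 * p) ℤ ∣
      Polynomial.X ^ beta n T + Polynomial.X ^ beta n (insert i (insert j T)) := by
    refine cyclotomic_two_mul_dvd_X_pow_add_X_pow hpodd ?_ ?_
    · exact (dvd_sub h4 h2).trans (dvd_of_eq (by ring))
    · rw [Nat.odd_iff] at h1 ⊢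
      omega
  have hT2 : Polynomial.cyclotomic (2 * p) ℤ ∣
      Polynomial.X ^ beta n (insert i T) + Polynomial.X ^ beta n (insert j T) := by
    refine cyclotomic_two_mul_dvd_X_pow_add_X_pow hpodd ?_ ?_
    · exact (dvd_sub h3 h2).trans (dvd_of_eq (by ring))
    · rw [Nat.odd_iff] at h1 ⊢
      omega
  convert dvd_add hT1 hT2 using 1
  ring
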